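/- For θ ∈ (-π/2, π/2) \ {0}, the linear map V_θ defined on the span of Hermite functions by V_θ e_n(x) = e^{iθ/4} e_n(e^{iθ/2} x) is unbounded on L²(ℝ): there is no constant M with ‖V_θ e_n‖ ≤ M for all n. -/

import Mathlib

open MeasureTheory Complex Filter

noncomputable section

/-- The pseudo-bosonic annihilation operator `A_θ`. -/
def Aop (Ω θ : ℝ) (f : ℝ → ℂ) : ℝ → ℂ := fun x =>
  ((Real.sqrt (2 * Ω))⁻¹ : ℂ) *
    (Complex.exp (Complex.I * θ / 2) * Ω * x * f x
      + Complex.exp (-(Complex.I * θ / 2)) * deriv f x)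

/-- The pseudo-bosonic creation operator `B_θ`. -/
def Bop (Ω θ : ℝ) (f : ℝ → ℂ) : ℝ → ℂ := fun x =>
  ((Real.sqrt (2 * Ω))⁻¹ : ℂ) *
    (Complex.exp (Complex.I * θ / 2) * Ω * x * f x
      - Complex.exp (-(Complex.I * θ / 2)) * deriv f x)

/-- Physicists' Hermite polynomials, via `H_{n+1}(y) = 2y H_n(y) - H_n'(y)`. -/
def physHermite : ℕ → Polynomial ℤ
  | 0 => 1
  | n + 1 => 2 * Polynomial.X * physHermite n - Polynomial.derivative (physHermite n)

/-- The eigenfunctions `φ_n^{(θ)}` (with a general normalization constant `N`). -/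
def phiN (Ω θ : ℝ) (N : ℂ) (n : ℕ) : ℝ → ℂ := fun x =>
  N / Real.sqrt (2 ^ n * n.factorial) *
    Polynomial.aeval (Complex.exp (Complex.I * θ / 2) * Real.sqrt Ω * x) (physHermite n) *
    Complex.exp (-(1/2) * Ω * Complex.exp (Complex.I * θ) * x ^ 2)

/-- Legendre polynomials via the Rodrigues formula. -/
def legendreP (n : ℕ) : Polynomial ℝ :=
  Polynomial.C ((2 ^ n * n.factorial : ℝ)⁻¹) *
    (Polynomial.derivative^[n] ((Polynomial.X ^ 2 - 1) ^ n))

open Polynomial in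
lemma physHermite_deriv (n : ℕ) : derivative (physHermite (n+1)) = 2 * ((n:ℤ[X])+1) * physHermite n := by
  induction n with
  | zero => simp [physHermite]
  | succ n ih =>
    rw [physHermite, derivative_sub, ih, derivative_mul, ih]
    have h2 : physHermite (n+1) = 2 * X * physHermite n - derivative (physHermite n) := rfl
    have h3 : derivative (2 * ((n:ℤ[X])+1) * physHermite n) = 2 * ((n:ℤ[X])+1) * derivative (physHermite n) := by
      rw [derivative_mul]
      have : derivative (2 * ((n:ℤ[X])+1)) = 0 := by simp [derivative_mul]
      rw [this]; ring
    rw [h3]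
    have h4 : derivative (2 * X : ℤ[X]) = 2 := by simp [derivative_mul]
    rw [h4]
    push_cast
    linear_combination (-2 * ((n:ℤ[X])+1)) * h2

lemma integrable_poly_gauss (b : ℂ) (hb : 0 < b.re) (P : Polynomial ℂ) :
    Integrable (fun x : ℝ => P.eval (x:ℂ) * Complex.exp (-b * x ^ 2)) := by
  induction P using Polynomial.induction_on' with
  | add p q hp hq => exact (hp.add hq).congr (ae_of_all _ fun x => by simp [add_mul])
  | monomial n a =>
    have h := integrable_rpow_mul_exp_neg_mul_sq hb (s := n) (lt_of_lt_of_le (by norm_num) (Nat.cast_nonneg n))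
    have h1 : Integrable (fun x : ℝ => (x:ℂ) ^ n * Complex.exp (-b * x ^ 2)) := by
      refine h.norm.mono' (by fun_prop) (ae_of_all _ fun x => ?_)
      rw [norm_mul, norm_pow, norm_cexp_neg_mul_sq, Complex.norm_real, Real.rpow_natCast, norm_mul, norm_pow,
        Real.norm_of_nonneg (Real.exp_nonneg _)]
    exact (h1.const_mul a).congr (ae_of_all _ fun x => by simp [mul_assoc])

lemma herm_eval (w : ℂ) (n : ℕ) (x : ℂ) :
    (((physHermite n).map (Int.castRingHom ℂ)).comp (Polynomial.C w * Polynomial.X)).eval x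
      = Polynomial.aeval (w * x) (physHermite n) := by
  simp [Polynomial.eval_comp, Polynomial.aeval_def, Polynomial.eval_map]

lemma integrable_herm (w b : ℂ) (hb : 0 < b.re) (n : ℕ) :
    Integrable (fun x : ℝ => Polynomial.aeval (w * x) (physHermite n) * Complex.exp (-b * x ^ 2)) := by
  exact (integrable_poly_gauss b hb
    (((physHermite n).map (Int.castRingHom ℂ)).comp (Polynomial.C w * Polynomial.X))).congr
    (ae_of_all _ fun x => by simp only [herm_eval])

lemma integrable_herm_sq (w b : ℂ) (hb : 0 < b.re) (n : ℕ) :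
    Integrable (fun x : ℝ => ‖Polynomial.aeval (w * x) (physHermite n) * Complex.exp (-b * x ^ 2)‖ ^ 2) := by
  have := (integrable_poly_gauss (2 * b) (by simpa using hb)
    ((((physHermite n).map (Int.castRingHom ℂ)).comp (Polynomial.C w * Polynomial.X)) ^ 2)).norm
  refine this.congr (ae_of_all _ fun x => ?_)
  simp only [Polynomial.eval_pow, herm_eval]
  rw [← norm_pow, mul_pow, ← Complex.exp_nat_mul]
  congr 3
  push_cast; ring

lemma herm_rec (w b : ℂ) (hb : 0 < b.re) (n : ℕ) :
    b * ∫ x : ℝ, Polynomial.aeval (w * x) (physHermite (n+2)) * Complex.exp (-b * x ^ 2)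
     = 2 * (n+1) * (w ^ 2 - b) * ∫ x : ℝ, Polynomial.aeval (w * x) (physHermite n) * Complex.exp (-b * x ^ 2) := by
  have hd : ∀ x : ℝ, HasDerivAt (fun x : ℝ => Polynomial.aeval (w * x) (physHermite (n+1)) * Complex.exp (-b * x ^ 2))
     ((2 * (n+1) * Polynomial.aeval (w * x) (physHermite n) * w) * Complex.exp (-b * x ^ 2) +
       Polynomial.aeval (w * x) (physHermite (n+1)) * (Complex.exp (-b * x ^ 2) * (-b * (2 * x)))) x := by
    intro x
    have h1 : HasDerivAt (fun y : ℂ => Polynomial.aeval (w * y) (physHermite (n+1)) * Complex.exp (-b * y ^ 2))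
     ((2 * (n+1) * Polynomial.aeval (w * x) (physHermite n) * w) * Complex.exp (-b * x ^ 2) +
       Polynomial.aeval (w * x) (physHermite (n+1)) * (Complex.exp (-b * x ^ 2) * (-b * (2 * x)))) (x:ℂ) := by
      apply HasDerivAt.mul
      · have h2 := (physHermite (n+1)).hasDerivAt_aeval (w * (x:ℂ))
        rw [physHermite_deriv] at h2
        have h3 : HasDerivAt (fun y : ℂ => w * y) w (x:ℂ) := by
          simpa using (hasDerivAt_id (x:ℂ)).const_mul w
        have := h2.comp (x:ℂ) h3
        have h4 : Polynomial.aeval (w * (x:ℂ)) (2 : Polynomial ℤ) = 2 := map_ofNat _ 2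
        simpa [h4, Function.comp_def] using this
      · have h3 : HasDerivAt (fun y : ℂ => -b * y ^ 2) (-b * (2 * x)) (x:ℂ) := by
          simpa using (hasDerivAt_pow 2 (x:ℂ)).const_mul (-b)
        exact h3.cexp
    exact h1.comp_ofReal
  have e : ∀ x : ℝ, b * (Polynomial.aeval (w * x) (physHermite (n+2)) * Complex.exp (-b * x ^ 2))
      = 2 * (n+1) * (w ^ 2 - b) * (Polynomial.aeval (w * x) (physHermite n) * Complex.exp (-b * x ^ 2))
        - w * ((2 * (n+1) * Polynomial.aeval (w * x) (physHermite n) * w) * Complex.exp (-b * x ^ 2) +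
       Polynomial.aeval (w * x) (physHermite (n+1)) * (Complex.exp (-b * x ^ 2) * (-b * (2 * x)))) := by
    intro x
    rw [physHermite, physHermite_deriv]
    have h4 : Polynomial.aeval (w * (x:ℂ)) (2 : Polynomial ℤ) = 2 := map_ofNat _ 2
    simp [h4]
    ring
  have i0 := integrable_herm w b hb n
  have i1 := integrable_herm w b hb (n+1)
  have i2 := integrable_herm w b hb (n+2)
  by_cases hw : w = 0
  · subst hw
    simp only [zero_mul, sub_zero, mul_zero] at e
    rw [← integral_const_mul, ← integral_const_mul]
    exact integral_congr_ae (ae_of_all _ (by simpa using e))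
  have hi' : Integrable (fun x : ℝ => (2 * (n+1) * Polynomial.aeval (w * x) (physHermite n) * w) * Complex.exp (-b * x ^ 2) +
       Polynomial.aeval (w * x) (physHermite (n+1)) * (Complex.exp (-b * x ^ 2) * (-b * (2 * x)))) := by
    refine (((i0.const_mul (2 * (n+1) * (w ^ 2 - b))).sub (i2.const_mul b)).const_mul w⁻¹).congr
      (ae_of_all _ fun x => ?_)
    have := e x
    simp only [Pi.sub_apply]
    rw [this]
    field_simp
    ring
  have h0 := integral_eq_zero_of_hasDerivAt_of_integrable hd hi' i1
  rw [← integral_const_mul, integral_congr_ae (ae_of_all _ e), integral_sub (i0.const_mul _) (hi'.const_mul _),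
    integral_const_mul, integral_const_mul, h0]
  simp

lemma not_bdd (R K : ℝ) (hR : 1 < R) (u : ℕ → ℝ) (h0 : 0 < u 0)
    (hu : ∀ k, u (k+1) = (2*k+1)/(2*k+2) * R * u k) (hK : ∀ k, u k ≤ K) : False := by
  have h1 : ∀ k : ℕ, R ^ k * u 0 ≤ u k * (2*k+1) := by
    intro k
    induction k with
    | zero => simp
    | succ k ih =>
      have hp : 0 < R ^ k * u 0 := by positivity
      have huk : 0 < u k := by
        by_contra h
        push Not at h
        nlinarith [(Nat.cast_nonneg k : (0:ℝ) ≤ k)]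
      rw [hu, pow_succ]
      push_cast
      have : (2*(k:ℝ)+1)/(2*k+2) * (2*(k+1)+1) ≥ 2*k+1 := by
        rw [div_mul_eq_mul_div, ge_iff_le, le_div_iff₀ (by positivity)]
        nlinarith [(Nat.cast_nonneg k : (0:ℝ) ≤ k)]
      calc R ^ k * R * u 0 = R * (R ^ k * u 0) := by ring
        _ ≤ R * (u k * (2*k+1)) := by gcongr
        _ ≤ R * (u k * ((2*(k:ℝ)+1)/(2*k+2) * (2*(k+1)+1))) := by gcongr
        _ = _ := by ring
  have ht := tendsto_pow_const_div_const_pow_of_one_lt 1 hR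
  have hKpos : 0 < K := lt_of_lt_of_le h0 (hK 0)
  have := (ht.eventually (gt_mem_nhds (show (0:ℝ) < u 0 / (3 * K) by positivity))).and (eventually_ge_atTop 1)
  obtain ⟨k, hk, hk1⟩ := this.exists
  have hk1' : (1:ℝ) ≤ k := by exact_mod_cast hk1
  rw [div_lt_div_iff₀ (by positivity) (by positivity)] at hk
  have := h1 k
  have h3 := mul_le_mul_of_nonneg_right (hK k) (show (0:ℝ) ≤ 2*k+1 by positivity)
  nlinarith

/-- the operator `V_θ e_n (x) = e^{iθ/4} e_n(e^{iθ/2} x)` is unbounded on `L²(ℝ)`: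
no constant `M` bounds all the norms `‖V_θ e_n‖`. Here `e_n` is the (analytically continued)
`n`-th Hermite eigenfunction, so `V_θ e_n = φ_n^{(θ)}` with `N^{(θ)} = (Ω/π)^{1/4} e^{iθ/4}`. -/
theorem stmt9 (Ω θ : ℝ) (hΩ : 0 < Ω) (hθ : |θ| < Real.pi / 2) (hθ0 : θ ≠ 0) :
    ¬ ∃ M : ℝ, ∀ n : ℕ,
      Real.sqrt (∫ x : ℝ,
        ‖Complex.exp (Complex.I * θ / 4) *
          ((1 / Real.sqrt (2 ^ n * n.factorial) * ((Ω / Real.pi) ^ ((1:ℝ)/4) : ℝ)) *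
            Polynomial.aeval (Real.sqrt Ω * (Complex.exp (Complex.I * θ / 2) * x)) (physHermite n) *
            Complex.exp (-(Ω : ℂ) * (Complex.exp (Complex.I * θ / 2) * x) ^ 2 / 2))‖ ^ 2)
      ≤ M := by
  rintro ⟨M, hM⟩
  have hc : 0 < Real.cos θ := Real.cos_pos_of_mem_Ioo (abs_lt.mp hθ |>.imp (by intro h; linarith) id)
  have hs : Real.sin θ ≠ 0 := by
    have hpi := Real.pi_pos
    have := abs_lt.mp hθ
    intro h
    exact hθ0 ((Real.sin_eq_zero_iff_of_lt_of_lt (by linarith) (by linarith)).mp h)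
  set c := Real.cos θ with hcdef
  set S := Real.sin θ with hSdef
  have hE : Complex.exp (Complex.I * θ / 2) ^ 2 = ⟨c, S⟩ := by
    rw [← Complex.exp_nat_mul]
    have : ((2:ℕ):ℂ) * (Complex.I * θ / 2) = θ * Complex.I := by push_cast; ring
    rw [this]
    apply Complex.ext
    · rw [Complex.exp_ofReal_mul_I_re]
    · rw [Complex.exp_ofReal_mul_I_im]
  set z := Complex.exp (Complex.I * θ / 2) with hz
  set w : ℂ := Real.sqrt Ω * z with hw
  set A : ℂ := ⟨Ω * c / 2, Ω * S / 2⟩ with hA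
  set D : ℂ := ⟨Ω / 2, -(Ω * c / S)⟩ with hD
  have hwA : w ^ 2 = 2 * A := by
    rw [hw, mul_pow, hE, ← Complex.ofReal_pow, Real.sq_sqrt hΩ.le]
    apply Complex.ext <;> simp [hA] <;> ring
  have hΩz : Ω * z ^ 2 = 2 * A := by
    rw [hE]
    apply Complex.ext <;> simp [hA] <;> ring
  have hAre : 0 < A.re := by simp only [hA]; positivity
  have hDre : 0 < D.re := by simp only [hD]; positivity
  have hBre : 0 < (A + D).re := by rw [Complex.add_re]; positivity
  have hB0 : A + D ≠ 0 := fun h => by rw [h] at hBre; simp at hBre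
  have hR : 1 < Complex.normSq (A - D) / Complex.normSq (A + D) := by
    rw [one_lt_div (Complex.normSq_pos.mpr hB0)]
    have : Complex.normSq (A - D) - Complex.normSq (A + D) = Ω ^ 2 * c := by
      simp only [Complex.normSq_apply, hA, hD, Complex.add_re, Complex.sub_re, Complex.add_im, Complex.sub_im]
      field_simp
      ring
    have : 0 < Ω ^ 2 * c := by positivity
    linarith
  set J : ℕ → ℂ := fun n => ∫ x : ℝ, Polynomial.aeval (w * x) (physHermite n) * Complex.exp (-(A + D) * x ^ 2) with hJ
  have hJrec : ∀ n : ℕ, (A + D) * J (n+2) = 2 * (n+1) * (A - D) * J n := by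
    intro n
    have := herm_rec w (A + D) hBre n
    rw [hwA] at this
    rw [hJ]
    simp only
    rw [this]
    ring
  have hJ0 : J 0 ≠ 0 := by
    have : J 0 = ((Real.pi : ℂ) / (A + D)) ^ (1 / 2 : ℂ) := by
      rw [hJ]
      simpa [physHermite] using integral_gaussian_complex hBre
    rw [this]
    have : (Real.pi : ℂ) / (A + D) ≠ 0 := div_ne_zero (by exact_mod_cast Real.pi_ne_zero) hB0
    simp [Complex.cpow_eq_zero_iff, this, Real.pi_ne_zero, hB0]
  set q : ℝ := (Ω / Real.pi) ^ ((1:ℝ)/4) with hq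
  have hqpos : 0 < q := Real.rpow_pos_of_pos (div_pos hΩ Real.pi_pos) _
  set G : ℝ := ∫ x : ℝ, ‖Complex.exp (-D * x ^ 2)‖ ^ 2 with hG
  have hGi : Integrable (fun x : ℝ => ‖Complex.exp (-D * x ^ 2)‖ ^ 2) := by
    simpa [physHermite] using integrable_herm_sq 1 D hDre 0
  have hbound : ∀ n : ℕ, q / Real.sqrt (2 ^ n * n.factorial) * ‖J n‖ ≤ (M ^ 2 + G) / 2 := by
    intro n
    set t : ℝ := q / Real.sqrt (2 ^ n * n.factorial) with ht
    have htpos : 0 < t := by positivity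
    have hMn := hM n
    have hfe : ∀ x : ℝ, ‖Complex.exp (Complex.I * θ / 4) *
          ((1 / Real.sqrt (2 ^ n * n.factorial) * (q : ℝ)) *
            Polynomial.aeval (Real.sqrt Ω * (z * x)) (physHermite n) *
            Complex.exp (-(Ω : ℂ) * (z * x) ^ 2 / 2))‖ ^ 2
          = t ^ 2 * ‖Polynomial.aeval (w * x) (physHermite n) * Complex.exp (-A * x ^ 2)‖ ^ 2 := by
      intro x
      have e1 : -(Ω : ℂ) * (z * x) ^ 2 / 2 = -A * x ^ 2 := by
        linear_combination (-(x:ℂ)^2/2) * hΩz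
      have e2 : Real.sqrt Ω * (z * x) = w * x := by rw [hw]; ring
      have e3 : ‖Complex.exp (Complex.I * θ / 4)‖ = 1 := by
        have : Complex.I * θ / 4 = ((θ / 4 : ℝ) : ℂ) * Complex.I := by push_cast; ring
        rw [this, Complex.norm_exp_ofReal_mul_I]
      have e4 : (1 / (Real.sqrt (2 ^ n * n.factorial) : ℂ) * (q : ℂ)) = ((t : ℝ) : ℂ) := by
        rw [ht]; push_cast; ring
      rw [e1, e2, norm_mul, e3, e4, mul_assoc, norm_mul, Complex.norm_real, Real.norm_of_nonneg htpos.le]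
      ring
    simp only [hfe] at hMn
    have hi := (integrable_herm_sq w A hAre n).const_mul (t ^ 2)
    have hnn : 0 ≤ ∫ x : ℝ, t ^ 2 * ‖Polynomial.aeval (w * x) (physHermite n) * Complex.exp (-A * x ^ 2)‖ ^ 2 :=
      integral_nonneg fun x => by positivity
    have hI : ∫ x : ℝ, t ^ 2 * ‖Polynomial.aeval (w * x) (physHermite n) * Complex.exp (-A * x ^ 2)‖ ^ 2 ≤ M ^ 2 := by
      exact (Real.sqrt_le_left ((Real.sqrt_nonneg _).trans hMn)).mp hMn
    have hJn : ‖J n‖ ≤ ∫ x : ℝ, ‖Polynomial.aeval (w * x) (physHermite n) * Complex.exp (-(A + D) * x ^ 2)‖ :=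
      norm_integral_le_integral_norm _
    calc t * ‖J n‖ ≤ t * ∫ x : ℝ, ‖Polynomial.aeval (w * x) (physHermite n) * Complex.exp (-(A + D) * x ^ 2)‖ := by gcongr
      _ = ∫ x : ℝ, t * ‖Polynomial.aeval (w * x) (physHermite n) * Complex.exp (-(A + D) * x ^ 2)‖ := by
        rw [integral_const_mul]
      _ ≤ ∫ x : ℝ, (t ^ 2 * ‖Polynomial.aeval (w * x) (physHermite n) * Complex.exp (-A * x ^ 2)‖ ^ 2
            + ‖Complex.exp (-D * x ^ 2)‖ ^ 2) / 2 := by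
        refine integral_mono ((integrable_herm w _ hBre n).norm.const_mul t) ((hi.add hGi).div_const 2) fun x => ?_
        have e : Complex.exp (-(A + D) * x ^ 2) = Complex.exp (-A * x ^ 2) * Complex.exp (-D * x ^ 2) := by
          rw [← Complex.exp_add]; congr 1; ring
        simp only
        rw [e, ← mul_assoc, norm_mul]
        nlinarith [sq_nonneg (t * ‖Polynomial.aeval (w * x) (physHermite n) * Complex.exp (-A * x ^ 2)‖ - ‖Complex.exp (-D * x ^ 2)‖)]
      _ = ((∫ x : ℝ, t ^ 2 * ‖Polynomial.aeval (w * x) (physHermite n) * Complex.exp (-A * x ^ 2)‖ ^ 2) + G) / 2 := by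
        rw [integral_div, integral_add hi hGi]
      _ ≤ _ := by gcongr
  refine not_bdd _ (((M ^ 2 + G) / 2) ^ 2) hR
    (fun k => q ^ 2 / (2 ^ (2*k) * (2*k).factorial) * Complex.normSq (J (2*k))) ?_ ?_ ?_
  · have := Complex.normSq_pos.mpr hJ0
    simp only [mul_zero]
    positivity
  · intro k
    have h := congrArg Complex.normSq (hJrec (2*k))
    have hcast : (2 * (((2*k : ℕ):ℂ) + 1)) = ((2 * (2*k+1) : ℝ) : ℂ) := by push_cast; ring
    rw [hcast, Complex.normSq_mul, Complex.normSq_mul, Complex.normSq_mul, Complex.normSq_ofReal] at h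
    have hBp := Complex.normSq_pos.mpr hB0
    have h' : Complex.normSq (J (2*(k+1))) = (2 * (2*k+1) * (2 * (2*k+1))) * Complex.normSq (A - D) * Complex.normSq (J (2*k)) / Complex.normSq (A + D) := by
      rw [eq_div_iff hBp.ne', ← h]; ring_nf
    rw [h']
    have hf : ((2*(k+1)).factorial : ℝ) = (2*k+2) * (2*k+1) * (2*k).factorial := by
      rw [show 2*(k+1) = 2*k+1+1 by ring, Nat.factorial_succ, Nat.factorial_succ]
      push_cast; ring
    rw [hf, show 2*(k+1) = 2*k+2 by ring, pow_add]
    field_simp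
  · intro k
    have h := hbound (2*k)
    have h2 := pow_le_pow_left₀ (by positivity) h 2
    rw [mul_pow, div_pow, Real.sq_sqrt (by positivity)] at h2
    rw [Complex.normSq_eq_norm_sq]
    exact h2
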